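/- arXiv:1501.07515 — 8 statements merged into one kernel-verified Lean document; each statement's English description precedes it below -/
import Mathlib

section
/- Let k be a field of characteristic p > 0 and V a finite-dimensional k-vector space. Then the multilinearization map φ: S^p(V) → ⊗^p V has image exactly S''_p(V), and its kernel is exactly the k-linear span of the p-th powers { v^p := ρ(v ⊗ v ⊗ ⋯ ⊗ v) : v ∈ V } ⊆ S^p(V). Moreover the map V → S^p(V), v ↦ v^p, is additive, p-semilinear (λv ↦ λ^p v^p), and injective. In other words, the sequence 0 → span_k{v^p : v ∈ V} → S^p(V) →^φ S''_p(V) → 0 is exact. -/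
/-!
STATEMENT 0: Let k be a field of characteristic p > 0 and V a finite-dimensional
k-vector space.  The multilinearization map φ : S^p(V) → ⊗^p V (the unique linear
map with φ ∘ ρ = s, where ρ : ⊗^p V → S^p(V) is the quotient map and s the
symmetrization map) exists; its image is exactly S''_p(V) and its kernel is exactly
the k-span of the p-th powers v^p = ρ(v ⊗ ⋯ ⊗ v).  Moreover v ↦ v^p is additive,
p-semilinear and injective.
-/

open scoped TensorProduct

variable (k : Type*) [Field k] (V : Type*) [AddCommGroup V] [Module k V] (n : ℕ)

/-- The action of a permutation `σ` on the `n`-th tensor power of `V`,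
permuting the tensor factors. -/
noncomputable def permAct (σ : Equiv.Perm (Fin n)) :
    (⨂[k] (_ : Fin n), V) →ₗ[k] ⨂[k] (_ : Fin n), V :=
  (PiTensorProduct.reindex k (fun _ : Fin n => V) σ).toLinearMap

/-- The symmetrization map `s : ⊗^n V → ⊗^n V`, `s(x) = ∑_{σ ∈ Σ_n} σ x`. -/
noncomputable def symmetrize : (⨂[k] (_ : Fin n), V) →ₗ[k] ⨂[k] (_ : Fin n), V :=
  ∑ σ : Equiv.Perm (Fin n), permAct k V n σ

/-- `S''_n(V)`, the space of symmetrized tensors: the image of the symmetrization map. -/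
noncomputable def symmetrizedTensors : Submodule k (⨂[k] (_ : Fin n), V) :=
  LinearMap.range (symmetrize k V n)

/-- The submodule of relations defining the symmetric power: the span of all
`x - σ x`. -/
noncomputable def symRel : Submodule k (⨂[k] (_ : Fin n), V) :=
  Submodule.span k
    {x | ∃ (y : ⨂[k] (_ : Fin n), V) (σ : Equiv.Perm (Fin n)), x = y - permAct k V n σ y}

/-- The `n`-th symmetric power `S^n(V)`, as the quotient of `⊗^n V` by the
relations `x - σx`. -/
noncomputable abbrev SymPow := (⨂[k] (_ : Fin n), V) ⧸ symRel k V n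

/-- The quotient map `ρ : ⊗^n V → S^n(V)`. -/
noncomputable def symQuot : (⨂[k] (_ : Fin n), V) →ₗ[k] SymPow k V n :=
  (symRel k V n).mkQ

/-- The `n`-th power map `v ↦ v^n := ρ(v ⊗ ⋯ ⊗ v)`. -/
noncomputable def pthPower (v : V) : SymPow k V n :=
  symQuot k V n (PiTensorProduct.tprod k fun _ : Fin n => v)

section Reindexing

variable {κ : Type*}

/-- A chosen representative of the orbit of `f : Fin n → κ` under reindexing by permutations. -/
noncomputable def orbitRep {n : ℕ} (f : Fin n → κ) : Fin n → κ :=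
  @Classical.epsilon _ ⟨f⟩ fun g => ∃ σ : Equiv.Perm (Fin n), f ∘ σ = g

theorem exists_comp_iff_of_comp {n : ℕ} (f : Fin n → κ) (τ : Equiv.Perm (Fin n))
    (h : Fin n → κ) :
    (∃ σ : Equiv.Perm (Fin n), (f ∘ τ) ∘ σ = h) ↔ ∃ σ : Equiv.Perm (Fin n), f ∘ σ = h := by
  constructor
  · rintro ⟨σ, rfl⟩
    exact ⟨τ * σ, rfl⟩
  · rintro ⟨σ, rfl⟩
    refine ⟨τ⁻¹ * σ, ?_⟩
    funext i
    simp

theorem orbitRep_comp {n : ℕ} (f : Fin n → κ) (τ : Equiv.Perm (Fin n)) :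
    orbitRep (f ∘ τ) = orbitRep f := by
  simp only [orbitRep, exists_comp_iff_of_comp]

theorem exists_comp_eq_orbitRep {n : ℕ} (f : Fin n → κ) :
    ∃ σ : Equiv.Perm (Fin n), f ∘ σ = orbitRep f := by
  exact Classical.epsilon_spec (p := fun g => ∃ σ : Equiv.Perm (Fin n), f ∘ σ = g) ⟨f, 1, rfl⟩

/-- The number of permutations carrying `f` to its orbit representative. -/
noncomputable def repCount {n : ℕ} (f : Fin n → κ) : ℕ :=
  Nat.card {σ : Equiv.Perm (Fin n) // f ∘ σ = orbitRep f}

theorem repCount_eq_card_stabilizer {n : ℕ} (f : Fin n → κ) :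
    repCount f = Nat.card {σ : Equiv.Perm (Fin n) // f ∘ σ = f} := by
  obtain ⟨τ, hτ⟩ := exists_comp_eq_orbitRep f
  refine Nat.card_congr ((Equiv.mulRight τ⁻¹).subtypeEquiv fun σ => ?_)
  simp only [← hτ, Equiv.coe_mulRight, Equiv.Perm.coe_mul, funext_iff, Function.comp_apply]
  constructor
  · intro h i
    simpa using h (τ⁻¹ i)
  · intro h i
    simpa using h (τ i)

theorem repCount_comp {n : ℕ} (f : Fin n → κ) (τ : Equiv.Perm (Fin n)) :
    repCount (f ∘ τ) = repCount f := by
  refine Nat.card_congr ((Equiv.mulLeft τ).subtypeEquiv fun σ => ?_)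
  rw [orbitRep_comp]
  rfl

theorem repCount_const (n : ℕ) (c : κ) : repCount (fun _ : Fin n => c) = n.factorial := by
  rw [repCount_eq_card_stabilizer]
  calc
    _ = Nat.card (Equiv.Perm (Fin n)) := Nat.card_congr (Equiv.subtypeUnivEquiv fun _ => rfl)
    _ = n.factorial := by rw [Nat.card_perm, Nat.card_fin]

theorem not_dvd_repCount [Finite κ] {p : ℕ} (hp : p.Prime) {f : Fin p → κ}
    (hf : ∀ c, f ≠ fun _ => c) : ¬ p ∣ repCount f := by
  classical
  have := Fintype.ofFinite κ
  rw [repCount_eq_card_stabilizer, Nat.card_eq_fintype_card, DomMulAct.stabilizer_card,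
    hp.prime.dvd_finsetProd_iff]
  rintro ⟨c, -, hc⟩
  rw [hp.dvd_factorial, Fintype.card_subtype] at hc
  refine hf c (funext fun i => ?_)
  have h : ({a | f a = c} : Finset (Fin p)) = Finset.univ :=
    Finset.eq_univ_of_card _ (le_antisymm (Finset.card_le_univ _) (by simpa using hc))
  simpa using (Finset.ext_iff.1 h i)

/-- The weight supported on orbit representatives whose sum over the `Fin n`-permutations of `f`
is `1` as soon as the stabilizer of `f` has invertible order. -/
noncomputable def orbitWeight {n : ℕ} (f : Fin n → κ) : k :=
  open Classical in if f = orbitRep f then (repCount f : k)⁻¹ else 0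

theorem sum_orbitWeight {n : ℕ} (f : Fin n → κ) :
    ∑ σ : Equiv.Perm (Fin n), orbitWeight k (f ∘ σ) = (repCount f : k) * (repCount f : k)⁻¹ := by
  classical
  simp only [orbitWeight, orbitRep_comp, repCount_comp]
  rw [← Finset.sum_filter, Finset.sum_const, nsmul_eq_mul, repCount, Nat.card_eq_fintype_card,
    Fintype.card_subtype]

end Reindexing

section SymmetricPower

variable {k V n}

theorem permAct_tprod (σ : Equiv.Perm (Fin n)) (v : Fin n → V) :
    permAct k V n σ (PiTensorProduct.tprod k v) =
      PiTensorProduct.tprod k fun i => v (σ⁻¹ i) :=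
  PiTensorProduct.reindex_tprod σ v

theorem symQuot_permAct (σ : Equiv.Perm (Fin n)) (x : ⨂[k] (_ : Fin n), V) :
    symQuot k V n (permAct k V n σ x) = symQuot k V n x :=
  ((Submodule.Quotient.eq (symRel k V n)).2 (Submodule.subset_span ⟨x, σ, rfl⟩)).symm

theorem symmetrize_permAct (σ : Equiv.Perm (Fin n)) (x : ⨂[k] (_ : Fin n), V) :
    symmetrize k V n (permAct k V n σ x) = symmetrize k V n x := by
  simp only [symmetrize, LinearMap.sum_apply]
  refine Fintype.sum_equiv (Equiv.mulRight σ) _ _ fun τ => ?_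
  suffices h : permAct k V n τ ∘ₗ permAct k V n σ = permAct k V n (τ * σ) from
    LinearMap.congr_fun h x
  ext v
  simp only [LinearMap.compMultilinearMap_apply, LinearMap.comp_apply, permAct_tprod]
  rfl

theorem symRel_le_ker {W : Type*} [AddCommGroup W] [Module k W]
    (g : (⨂[k] (_ : Fin n), V) →ₗ[k] W)
    (hg : ∀ σ x, g (permAct k V n σ x) = g x) : symRel k V n ≤ LinearMap.ker g := by
  refine Submodule.span_le.2 ?_
  rintro _ ⟨y, σ, rfl⟩
  simp [hg]

theorem symmetrize_tprod_const (v : V) :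
    symmetrize k V n (PiTensorProduct.tprod k fun _ => v) =
      (n.factorial : k) • PiTensorProduct.tprod k fun _ => v := by
  simp [symmetrize, permAct_tprod, Fintype.card_perm, Nat.cast_smul_eq_nsmul]

variable {κ : Type*} (b : Module.Basis κ k V)

/-- The coordinate of a tensor at the diagonal basis tensor `b i ⊗ ⋯ ⊗ b i`. -/
noncomputable def diagCoord (n : ℕ) (i : κ) : (⨂[k] (_ : Fin n), V) →ₗ[k] k :=
  (Basis.piTensorProduct fun _ : Fin n => b).coord fun _ => i

theorem diagCoord_tprod (i : κ) (v : Fin n → V) :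
    diagCoord b n i (PiTensorProduct.tprod k v) = ∏ j, b.repr (v j) i := by
  simp [diagCoord, Basis.piTensorProduct_repr_tprod_apply]

theorem diagCoord_permAct (i : κ) (σ : Equiv.Perm (Fin n)) (x : ⨂[k] (_ : Fin n), V) :
    diagCoord b n i (permAct k V n σ x) = diagCoord b n i x := by
  suffices h : diagCoord b n i ∘ₗ permAct k V n σ = diagCoord b n i from LinearMap.congr_fun h x
  ext v
  simp only [LinearMap.compMultilinearMap_apply, LinearMap.comp_apply, permAct_tprod,
    diagCoord_tprod]
  exact Equiv.prod_comp σ⁻¹ fun j => b.repr (v j) i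

theorem diagCoord_liftQ_pthPower (i : κ) (v : V) :
    (symRel k V n).liftQ (diagCoord b n i) (symRel_le_ker _ (diagCoord_permAct b i))
      (pthPower k V n v) = b.repr v i ^ n := by
  rw [pthPower, symQuot, Submodule.mkQ_apply, Submodule.liftQ_apply, diagCoord_tprod]
  simp

variable [Fintype κ]

/-- In prime degree equal to the characteristic, the quotient map to the symmetric power factors
through symmetrization up to a combination of `p`-th powers of basis vectors. -/
theorem exists_symQuot_eq {p : ℕ} (hp : p.Prime) [CharP k p] :
    ∃ ψ : (⨂[k] (_ : Fin p), V) →ₗ[k] SymPow k V p, ∀ x,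
      symQuot k V p x = ψ (symmetrize k V p x) + ∑ i, diagCoord b p i x • pthPower k V p (b i) := by
  classical
  let B := Basis.piTensorProduct fun _ : Fin p => b
  have hB (f : Fin p → κ) : B f = PiTensorProduct.tprod k fun j => b (f j) :=
    Basis.piTensorProduct_apply _ f
  let ψ : (⨂[k] (_ : Fin p), V) →ₗ[k] SymPow k V p :=
    B.constr k fun f => orbitWeight k f • symQuot k V p (B f)
  have hperm (f : Fin p → κ) (σ : Equiv.Perm (Fin p)) :
      permAct k V p σ (B f) = B (f ∘ ⇑σ⁻¹) := by
    rw [hB, hB, permAct_tprod]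
    rfl
  have hψ (f : Fin p → κ) : ψ (symmetrize k V p (B f)) =
      ((repCount f : k) * (repCount f : k)⁻¹) • symQuot k V p (B f) := by
    rw [← sum_orbitWeight, ← Equiv.sum_comp (Equiv.inv _), Finset.sum_smul, symmetrize,
      LinearMap.sum_apply, map_sum]
    refine Finset.sum_congr rfl fun σ _ => ?_
    rw [← symQuot_permAct σ (B f), hperm, Module.Basis.constr_basis]
    rfl
  have hdiag (f : Fin p → κ) (i : κ) :
      diagCoord b p i (B f) = if f = fun _ => i then 1 else 0 := by
    change B.coord _ (B f) = _
    rw [Module.Basis.coord_apply, Module.Basis.repr_self, Finsupp.single_apply]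
  refine ⟨ψ, fun x => ?_⟩
  suffices h : symQuot k V p = ψ ∘ₗ symmetrize k V p +
      ∑ i, (diagCoord b p i).smulRight (pthPower k V p (b i)) by
    simpa using LinearMap.congr_fun h x
  refine B.ext fun f => ?_
  simp only [LinearMap.add_apply, LinearMap.comp_apply, LinearMap.sum_apply,
    LinearMap.smulRight_apply, hψ, hdiag]
  by_cases hf : ∃ c, f = fun _ => c
  · obtain ⟨c, rfl⟩ := hf
    have h0 : (repCount (fun _ : Fin p => c) : k) = 0 := by
      rw [repCount_const, CharP.cast_eq_zero_iff k p]
      exact Nat.dvd_factorial hp.pos le_rfl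
    have hinj (i : κ) : ((fun _ : Fin p => c) = fun _ => i) ↔ c = i :=
      ⟨fun h => congr_fun h ⟨0, hp.pos⟩, fun h => h ▸ rfl⟩
    simp [h0, hinj, hB, pthPower]
  · push Not at hf
    have h0 : (repCount f : k) ≠ 0 := by
      rw [Ne, CharP.cast_eq_zero_iff k p]
      exact not_dvd_repCount hp hf
    simp [h0, hf]

theorem pthPower_eq_sum {p : ℕ} (hp : p.Prime) [CharP k p] (v : V) :
    pthPower k V p v = ∑ i, b.repr v i ^ p • pthPower k V p (b i) := by
  obtain ⟨ψ, hψ⟩ := exists_symQuot_eq b hp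
  have h0 : (p.factorial : k) = 0 := by
    rw [CharP.cast_eq_zero_iff k p]
    exact Nat.dvd_factorial hp.pos le_rfl
  rw [pthPower, hψ, symmetrize_tprod_const, h0]
  simp [diagCoord_tprod]

end SymmetricPower

theorem stmt0 (p : ℕ) (hp : 0 < p) [CharP k p] [FiniteDimensional k V] :
    -- the multilinearization map φ (characterized by φ ∘ ρ = s) exists ...
    (∃ φ : SymPow k V p →ₗ[k] ⨂[k] (_ : Fin p), V,
        φ ∘ₗ symQuot k V p = symmetrize k V p) ∧
    -- ... and any such φ has image S''_p(V) and kernel the span of the p-th powers,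
    -- i.e. 0 → span{v^p} → S^p(V) → S''_p(V) → 0 is exact
    (∀ φ : SymPow k V p →ₗ[k] ⨂[k] (_ : Fin p), V,
        φ ∘ₗ symQuot k V p = symmetrize k V p →
        LinearMap.range φ = symmetrizedTensors k V p ∧
        LinearMap.ker φ = Submodule.span k (Set.range (pthPower k V p))) ∧
    -- the p-th power map is additive ...
    (∀ v w : V, pthPower k V p (v + w) = pthPower k V p v + pthPower k V p w) ∧
    -- ... p-semilinear ...
    (∀ (c : k) (v : V), pthPower k V p (c • v) = c ^ p • pthPower k V p v) ∧
    -- ... and injective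
    Function.Injective (pthPower k V p) := by
  have hpr : p.Prime := (CharP.char_is_prime_or_zero k p).resolve_right hp.ne'
  have := Fact.mk hpr
  let b := Module.finBasis k V
  refine ⟨⟨(symRel k V p).liftQ (symmetrize k V p) (symRel_le_ker _ symmetrize_permAct),
    (symRel k V p).liftQ_mkQ _ _⟩, fun φ hφ => ⟨?_, ?_⟩, fun v w => ?_, fun c v => ?_,
    fun v w hvw => ?_⟩
  · rw [symmetrizedTensors, ← hφ, LinearMap.range_comp_of_range_eq_top]
    exact Submodule.range_mkQ _
  · have hφ' (x) : φ (symQuot k V p x) = symmetrize k V p x := LinearMap.congr_fun hφ x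
    apply le_antisymm
    · intro y hy
      obtain ⟨x, rfl⟩ := Submodule.mkQ_surjective _ y
      obtain ⟨ψ, hψ⟩ := exists_symQuot_eq b hpr
      have h : symmetrize k V p x = 0 := (hφ' x).symm.trans hy
      change symQuot k V p x ∈ _
      rw [hψ, h, map_zero, zero_add]
      exact Submodule.sum_mem _ fun i _ =>
        Submodule.smul_mem _ _ (Submodule.subset_span ⟨b i, rfl⟩)
    · refine Submodule.span_le.2 ?_
      rintro _ ⟨v, rfl⟩
      have h0 : (p.factorial : k) = 0 := by
        rw [CharP.cast_eq_zero_iff k p]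
        exact Nat.dvd_factorial hp le_rfl
      rw [SetLike.mem_coe, LinearMap.mem_ker, pthPower, hφ', symmetrize_tprod_const, h0, zero_smul]
  · have := ExpChar.prime (R := k) hpr
    simp only [pthPower_eq_sum b hpr (v + w), pthPower_eq_sum b hpr v, pthPower_eq_sum b hpr w,
      map_add, Finsupp.add_apply, add_pow_char, add_smul, Finset.sum_add_distrib]
  · rw [pthPower, pthPower, (PiTensorProduct.tprod k).map_smul_univ (fun _ => c) fun _ => v]
    simp
  · refine b.ext_elem fun i => ?_
    have h := diagCoord_liftQ_pthPower (n := p) b i v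
    rw [hvw, diagCoord_liftQ_pthPower] at h
    exact (frobenius_inj k p h).symm
end

section
/- Let k be a field of characteristic p > 0 and V a k-vector space of finite dimension d. Then dim_k S''_p(V) = C(d + p − 1, p) − d, where C(·,·) denotes the binomial coefficient. (This corrects the erroneous formula in Bourbaki, Algebra, Ch. III §6, Exercise 5b.) -/
/-!
STATEMENT 2: Let k be a field of characteristic p > 0 and V a k-vector space of
finite dimension d.  Then dim_k S''_p(V) = C(d + p − 1, p) − d.
-/

open scoped TensorProduct

variable (k : Type*) [Field k] (V : Type*) [AddCommGroup V] [Module k V] (n : ℕ)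

/-- For prime `p`, a non-constant map out of `Fin p` has a stabilizer of order prime to `p`. -/
theorem not_dvd_card_perm_comp_eq {ι : Type*} [Fintype ι] [DecidableEq ι] {p : ℕ}
    (hp : p.Prime) {f : Fin p → ι} (hf : ∀ i, f ≠ Function.const _ i) :
    ¬ p ∣ Fintype.card {σ : Equiv.Perm (Fin p) // f ∘ σ = f} := by
  rw [DomMulAct.stabilizer_card, hp.prime.dvd_finsetProd_iff]
  rintro ⟨i, -, hi⟩
  rw [hp.dvd_factorial] at hi
  refine hf i (funext fun a => ?_)
  have h := (set_fintype_card_eq_univ_iff {a | f a = i}).1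
    (le_antisymm (set_fintype_card_le_univ _) (by simpa [Fintype.card_subtype] using hi))
  exact (Set.eq_univ_iff_forall.1 h) a

theorem Multiset.map_univ_val_eq_iff {α ι : Type*} [Fintype α] {f g : α → ι} :
    Finset.univ.val.map f = Finset.univ.val.map g ↔ ∃ σ : Equiv.Perm α, f = g ∘ σ := by
  classical
  constructor
  · intro h
    have e (i : ι) : Nonempty ({a // f a = i} ≃ {a // g a = i}) := by
      have hi := congrArg (Multiset.count i) h
      rw [Multiset.count_map, Multiset.count_map] at hi
      refine Fintype.card_eq.1 ?_
      simpa [Fintype.card_subtype, Finset.card_def, eq_comm] using hi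
    exact ⟨Equiv.ofFiberEquiv fun i => (e i).some,
      funext fun a => (Equiv.ofFiberEquiv_map _ a).symm⟩
  · rintro ⟨σ, rfl⟩
    rw [← Multiset.map_map, Multiset.map_univ_val_equiv]

/-- The multiset of values of a map, as an element of the symmetric power. -/
def symOfFun {ι : Type*} {n : ℕ} (f : Fin n → ι) : Sym ι n :=
  ⟨Finset.univ.val.map f, by simp⟩

theorem symOfFun_eq_iff {ι : Type*} {n : ℕ} {f g : Fin n → ι} :
    symOfFun f = symOfFun g ↔ ∃ σ : Equiv.Perm (Fin n), f = g ∘ σ := by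
  rw [← Sym.coe_inj]
  exact Multiset.map_univ_val_eq_iff (f := f) (g := g)

theorem symOfFun_surjective {ι : Type*} {n : ℕ} :
    Function.Surjective (symOfFun : (Fin n → ι) → Sym ι n) := by
  rintro ⟨s, hs⟩
  induction s using Quotient.inductionOn with
  | h l =>
    obtain rfl : l.length = n := hs
    exact ⟨l.get, Subtype.ext (by simp [symOfFun])⟩

theorem symOfFun_const {ι : Type*} {n : ℕ} (i : ι) :
    symOfFun (Function.const (Fin n) i) = Sym.replicate n i :=
  Sym.eq_replicate.2 (by simp [symOfFun])

section

variable {k V n} {ι : Type*} (b : Module.Basis ι k V)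

theorem permAct_basis (σ : Equiv.Perm (Fin n)) (f : Fin n → ι) :
    permAct k V n σ (Basis.piTensorProduct (fun _ => b) f) =
      Basis.piTensorProduct (fun _ => b) (f ∘ σ.symm) := by
  simp [permAct, Basis.piTensorProduct_apply, PiTensorProduct.reindex_tprod]

theorem symmetrize_basis (f : Fin n → ι) :
    symmetrize k V n (Basis.piTensorProduct (fun _ => b) f) =
      ∑ σ : Equiv.Perm (Fin n), Basis.piTensorProduct (fun _ => b) (f ∘ σ) := by
  simp only [symmetrize, LinearMap.sum_apply, permAct_basis]
  exact Equiv.sum_comp (Equiv.inv _) fun σ : Equiv.Perm (Fin n) =>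
    Basis.piTensorProduct (fun _ => b) (f ∘ σ)

theorem symmetrize_basis_comp (f : Fin n → ι) (τ : Equiv.Perm (Fin n)) :
    symmetrize k V n (Basis.piTensorProduct (fun _ => b) (f ∘ τ)) =
      symmetrize k V n (Basis.piTensorProduct (fun _ => b) f) := by
  simp only [symmetrize_basis]
  exact Equiv.sum_comp (Equiv.mulLeft τ) fun σ : Equiv.Perm (Fin n) =>
    Basis.piTensorProduct (fun _ => b) (f ∘ σ)

theorem repr_symmetrize_basis [DecidableEq ι] (f g : Fin n → ι) :
    (Basis.piTensorProduct fun _ => b).repr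
        (symmetrize k V n (Basis.piTensorProduct (fun _ => b) f)) g =
      (Fintype.card {σ : Equiv.Perm (Fin n) // f ∘ σ = g} : k) := by
  rw [symmetrize_basis]
  simp [-Basis.piTensorProduct_apply, Finsupp.single_apply, Fintype.card_subtype]

theorem symmetrize_basis_const {p : ℕ} (hp : 0 < p) [CharP k p] (i : ι) :
    symmetrize k V p (Basis.piTensorProduct (fun _ => b) (Function.const _ i)) = 0 := by
  have h : (p.factorial : k) = 0 :=
    (CharP.cast_eq_zero_iff k p _).2 (Nat.dvd_factorial hp le_rfl)
  rw [symmetrize_basis]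
  simp [Function.comp_def, Fintype.card_perm, ← Nat.cast_smul_eq_nsmul k, h]

/-- The symmetrization of the basis tensor attached to a multiset of basis indices. -/
noncomputable def symmetrizedBasisTensor (s : Sym ι n) : ⨂[k] (_ : Fin n), V :=
  symmetrize k V n (Basis.piTensorProduct (fun _ => b)
    (Function.surjInv symOfFun_surjective s))

theorem symmetrizedBasisTensor_symOfFun (f : Fin n → ι) :
    symmetrizedBasisTensor b (symOfFun f) =
      symmetrize k V n (Basis.piTensorProduct (fun _ => b) f) := by
  obtain ⟨σ, hσ⟩ := symOfFun_eq_iff.1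
    (Function.surjInv_eq (symOfFun_surjective (ι := ι) (n := n)) (symOfFun f))
  rw [symmetrizedBasisTensor, hσ, symmetrize_basis_comp]

theorem span_symmetrizedBasisTensor {p : ℕ} (hp : 0 < p) [CharP k p] :
    Submodule.span k (Set.range fun s : {s : Sym ι p // s ∉ Set.range (Sym.replicate p)} =>
      symmetrizedBasisTensor b s.1) = symmetrizedTensors k V p := by
  apply le_antisymm
  · rw [Submodule.span_le]
    rintro _ ⟨s, rfl⟩
    exact LinearMap.mem_range_self _ _
  · rw [symmetrizedTensors, LinearMap.range_eq_map,
      ← (Basis.piTensorProduct fun _ : Fin p => b).span_eq, Submodule.map_span,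
      Submodule.span_le]
    rintro _ ⟨_, ⟨f, rfl⟩, rfl⟩
    by_cases hf : symOfFun f ∈ Set.range (Sym.replicate p)
    · obtain ⟨i, hi⟩ := hf
      rw [← symmetrizedBasisTensor_symOfFun, ← hi, ← symOfFun_const,
        symmetrizedBasisTensor_symOfFun, symmetrize_basis_const b hp]
      exact zero_mem _
    · exact Submodule.subset_span ⟨⟨_, hf⟩, symmetrizedBasisTensor_symOfFun b f⟩

theorem linearIndependent_symmetrizedBasisTensor [Fintype ι] {p : ℕ} (hp : p.Prime)
    [CharP k p] :
    LinearIndependent k fun s : {s : Sym ι p // s ∉ Set.range (Sym.replicate p)} =>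
      symmetrizedBasisTensor b s.1 := by
  classical
  let r : Sym ι p → Fin p → ι := Function.surjInv symOfFun_surjective
  have hr : ∀ s, symOfFun (r s) = s := Function.surjInv_eq symOfFun_surjective
  rw [linearIndependent_iff']
  intro S c hc t ht
  have h := congrArg (fun x => (Basis.piTensorProduct fun _ => b).repr x (r t)) hc
  simp only [map_sum, map_smul, Finsupp.coe_finsetSum, Finset.sum_apply, Finsupp.smul_apply,
    symmetrizedBasisTensor, map_zero, Finsupp.zero_apply] at h
  rw [Finset.sum_eq_single_of_mem t ht] at h
  · rw [repr_symmetrize_basis, smul_eq_mul, mul_eq_zero, CharP.cast_eq_zero_iff k p] at h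
    refine h.resolve_right (not_dvd_card_perm_comp_eq hp fun i hi => t.2 ⟨i, ?_⟩)
    rw [← symOfFun_const, ← hi]
    exact hr t
  · intro s _ hst
    rw [repr_symmetrize_basis, Fintype.card_eq_zero_iff.2, Nat.cast_zero, smul_zero]
    refine ⟨fun ⟨σ, hσ⟩ => hst (Subtype.ext ?_)⟩
    rw [← hr s, ← hr t]
    exact (symOfFun_eq_iff.2 ⟨σ, hσ.symm⟩).symm

end

theorem Sym.card_not_mem_range_replicate {ι : Type*} [Fintype ι] [DecidableEq ι] {n : ℕ}
    (hn : n ≠ 0) [Fintype {s : Sym ι n // s ∉ Set.range (Sym.replicate n)}] :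
    Fintype.card {s : Sym ι n // s ∉ Set.range (Sym.replicate n)} =
      (Fintype.card ι + n - 1).choose n - Fintype.card ι := by
  classical
  have hinj : Function.Injective (Sym.replicate n : ι → Sym ι n) := fun i j hij => by
    have h : i ∈ Sym.replicate n j := hij ▸ Sym.mem_replicate.2 ⟨hn, rfl⟩
    exact (Sym.mem_replicate.1 h).2
  rw [← Sym.card_sym_eq_choose, ← Set.card_range_of_injective hinj]
  exact Fintype.card_subtype_compl _

theorem stmt2 (p : ℕ) (hp : 0 < p) [CharP k p] [FiniteDimensional k V]
    (d : ℕ) (hd : Module.finrank k V = d) :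
    Module.finrank k (symmetrizedTensors k V p) = (d + p - 1).choose p - d := by
  classical
  have hp' : p.Prime := (CharP.char_is_prime_or_zero k p).resolve_right hp.ne'
  let b := Module.finBasisOfFinrankEq k V hd
  rw [← span_symmetrizedBasisTensor b hp,
    finrank_span_eq_card (linearIndependent_symmetrizedBasisTensor b hp'),
    Sym.card_not_mem_range_replicate hp.ne', Fintype.card_fin]
end

section
/- Let k be a field of characteristic p > 0 and V a finite-dimensional k-vector space. A p-multilinear form f: V × ⋯ × V → k (p arguments) lies in the image of the symmetrization map on p-multilinear forms (i.e., f(v₁,…,v_p) = Σ_{σ∈Σ_p} g(v_{σ(1)},…,v_{σ(p)}) for some p-multilinear form g) if and only if f is symmetric (invariant under all permutations of its arguments) and characteristic, i.e., f(v, v, …, v) = 0 for all v ∈ V. -/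
/-!
STATEMENT 3: Let k be a field of characteristic p > 0 and V a finite-dimensional
k-vector space.  A p-multilinear form f on V is a symmetrization
f(v₁,…,v_p) = Σ_{σ∈Σ_p} g(v_{σ(1)},…,v_{σ(p)}) of some p-multilinear form g
if and only if f is symmetric and characteristic (f(v,…,v) = 0 for all v).
-/

/-- A function on `Fin p`, with `p` prime, whose stabilizer in `Equiv.Perm (Fin p)` has order
divisible by `p` is constant. -/
theorem eq_const_of_prime_dvd_card_stabilizer {ι : Type*} {p : ℕ} (hp : p.Prime) (r : Fin p → ι)
    (h : p ∣ Nat.card {σ : Equiv.Perm (Fin p) // r ∘ σ = r}) (a b : Fin p) : r a = r b := by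
  have : Fact p.Prime := ⟨hp⟩
  let H : Subgroup (Equiv.Perm (Fin p)) :=
    { carrier := {σ | r ∘ σ = r}
      mul_mem' := fun {σ τ} hσ hτ => by
        simp only [Set.mem_ofPred_eq] at hσ hτ ⊢
        rw [Equiv.Perm.coe_mul, ← Function.comp_assoc, hσ, hτ]
      one_mem' := rfl
      inv_mem' := fun {σ} hσ => by
        simp only [Set.mem_ofPred_eq] at hσ ⊢
        funext x
        simpa using (congrFun hσ (σ⁻¹ x)).symm }
  obtain ⟨⟨σ, hσ⟩, hord⟩ := exists_prime_orderOf_dvd_card' (G := H) p h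
  rw [Subgroup.orderOf_mk] at hord
  have hcyc : σ.IsCycle :=
    Equiv.Perm.isCycle_of_prime_order'' (by simpa using hp) (by simpa using hord)
  have hsupp : σ.support = Finset.univ := by
    rw [← Finset.card_eq_iff_eq_univ, ← hcyc.orderOf, hord, Fintype.card_fin]
  have hmoved (x : Fin p) : σ x ≠ x := by
    rw [← Equiv.Perm.mem_support, hsupp]
    exact Finset.mem_univ x
  obtain ⟨n, rfl⟩ := hcyc.exists_zpow_eq (hmoved a) (hmoved b)
  exact (congrFun (show r ∘ ⇑(σ ^ n) = r from H.zpow_mem hσ n) a).symm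

/-- A multilinear form with prescribed values on the tuples of vectors of a finite basis. -/
theorem Module.Basis.exists_multilinearMap_apply_eq {k V ι κ : Type*} [CommRing k] [AddCommGroup V]
    [Module k V] [Fintype ι] [Fintype κ] (b : Module.Basis ι k V)
    (c : (κ → ι) → k) :
    ∃ g : MultilinearMap k (fun _ : κ => V) k, ∀ i : κ → ι, g (b ∘ i) = c i := by
  classical
  refine ⟨∑ i : κ → ι, c i • (MultilinearMap.mkPiAlgebra k κ k).compLinearMap
    (fun j => b.coord (i j)), fun i => ?_⟩
  rw [_root_.sum_apply, Finset.sum_eq_single i]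
  · simp
  · intro i' _ hne
    obtain ⟨j, hj⟩ := Function.ne_iff.mp hne
    simp only [_root_.smul_apply, MultilinearMap.compLinearMap_apply,
      MultilinearMap.mkPiAlgebra_apply, smul_eq_mul]
    rw [Finset.prod_eq_zero (Finset.mem_univ j), mul_zero]
    simp [hj.symm]
  · simp

/-- A symmetric multilinear form that vanishes on the diagonal is a symmetrization: take a form
supported on the sorted tuples of basis vectors. -/
theorem MultilinearMap.exists_eq_sum_perm_of_symm_of_diag_eq_zero {k V : Type*} [Field k]
    [AddCommGroup V] [Module k V] [FiniteDimensional k V] {p : ℕ} (hp : p.Prime) [CharP k p]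
    (f : MultilinearMap k (fun _ : Fin p => V) k)
    (hsymm : ∀ (σ : Equiv.Perm (Fin p)) (v : Fin p → V), f (v ∘ σ) = f v)
    (hdiag : ∀ v : V, f (fun _ => v) = 0) :
    ∃ g : MultilinearMap k (fun _ : Fin p => V) k,
      ∀ v : Fin p → V, f v = ∑ σ : Equiv.Perm (Fin p), g (v ∘ σ) := by
  classical
  let b := Module.finBasis k V
  let N (i : Fin p → Fin (Module.finrank k V)) : ℕ :=
    Nat.card {σ : Equiv.Perm (Fin p) // i ∘ σ = i}
  obtain ⟨g, hg⟩ := b.exists_multilinearMap_apply_eq (κ := Fin p)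
    (fun i => if i ∘ Tuple.sort i = i then f (b ∘ i) / N i else 0)
  refine ⟨g, fun v => ?_⟩
  suffices f = ∑ σ : Equiv.Perm (Fin p), g.domDomCongr σ by
    conv_lhs => rw [this]
    rw [_root_.sum_apply]
    rfl
  refine Module.Basis.ext_multilinear (fun _ => b) fun i => ?_
  change f (b ∘ i) = _
  rw [_root_.sum_apply]
  change f (b ∘ i) = ∑ σ : Equiv.Perm (Fin p), g (b ∘ (i ∘ σ))
  set r := i ∘ Tuple.sort i with hr
  have hfr : f (b ∘ r) = f (b ∘ i) := hsymm (Tuple.sort i) (b ∘ i)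
  have hterm (σ : Equiv.Perm (Fin p)) :
      g (b ∘ (i ∘ σ)) = if i ∘ σ = r then f (b ∘ r) / N r else 0 := by
    rw [hg, Tuple.comp_perm_comp_sort_eq_comp_sort, ← hr]
    by_cases h : i ∘ σ = r
    · simp [h]
    · rw [if_neg h, if_neg (Ne.symm h)]
  have hcard : (∑ σ : Equiv.Perm (Fin p), if i ∘ σ = r then f (b ∘ r) / N r else 0) =
      N r * (f (b ∘ r) / N r) := by
    rw [← Equiv.sum_comp (Equiv.mulLeft (Tuple.sort i)), ← Finset.sum_filter, Finset.sum_const,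
      nsmul_eq_mul]
    congr 2
    simp only [N]
    rw [Nat.card_eq_fintype_card, Fintype.card_subtype]
    rfl
  rw [Finset.sum_congr rfl fun σ _ => hterm σ, hcard, ← hfr]
  by_cases hN : (N r : k) = 0
  · have hconst := eq_const_of_prime_dvd_card_stabilizer hp r ((CharP.cast_eq_zero_iff k p _).mp hN)
    have hzero : f (b ∘ r) = 0 := by
      rw [← hdiag (b (r ⟨0, hp.pos⟩))]
      congr 1
      funext x
      exact congrArg b (hconst _ _)
    simp [hzero]
  · rw [mul_div_cancel₀ _ hN]

theorem stmt3 (k : Type*) [Field k] (V : Type*) [AddCommGroup V] [Module k V]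
    [FiniteDimensional k V] (p : ℕ) (hp : 0 < p) [CharP k p]
    (f : MultilinearMap k (fun _ : Fin p => V) k) :
    (∃ g : MultilinearMap k (fun _ : Fin p => V) k,
        ∀ v : Fin p → V, f v = ∑ σ : Equiv.Perm (Fin p), g (v ∘ σ)) ↔
      ((∀ (σ : Equiv.Perm (Fin p)) (v : Fin p → V), f (v ∘ σ) = f v) ∧
        ∀ v : V, f (fun _ => v) = 0) := by
  have hprime : p.Prime := (CharP.char_is_prime_or_zero k p).resolve_right hp.ne'
  constructor
  · rintro ⟨g, hg⟩
    refine ⟨fun τ v => ?_, fun v => ?_⟩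
    · rw [hg, hg, ← Equiv.sum_comp (Equiv.mulLeft τ) fun σ : Equiv.Perm (Fin p) => g (v ∘ σ)]
      rfl
    · rw [hg]
      change ∑ _σ : Equiv.Perm (Fin p), g (fun _ => v) = 0
      rw [Finset.sum_const, Finset.card_univ, Fintype.card_perm, Fintype.card_fin, nsmul_eq_mul,
        (CharP.cast_eq_zero_iff k p _).mpr (Nat.dvd_factorial hp le_rfl), zero_mul]
  · rintro ⟨hsymm, hdiag⟩
    exact f.exists_eq_sum_perm_of_symm_of_diag_eq_zero hprime hsymm hdiag
end

section
/- Let k be a field of characteristic 2, G a group, and V a finite-dimensional linear representation of G over k. Let T denote the G-subrepresentation of the space of quadratic forms on V consisting of the totally singular quadratic forms (those with identically zero polar bilinear form), with G acting by (g·q)(v) = q(g⁻¹v). If the group cohomology H¹(G, T) vanishes, then every G-invariant alternating bilinear form on V is the polar bilinear form b_q of some G-invariant quadratic form q on V. -/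
/-!
STATEMENT 5: Let k be a field of characteristic 2, G a group, V a
finite-dimensional representation of G over k, and T the G-module of totally
singular quadratic forms on V (those with identically zero polar form), with G
acting by (g·q)(v) = q(g⁻¹ v).  If H¹(G, T) = 0 — i.e., every 1-cocycle of G with
values in T is a coboundary — then every G-invariant alternating bilinear form on
V is the polar form of some G-invariant quadratic form on V.
-/

/-- In characteristic two, every alternating bilinear form on a finite-dimensional vector space is
the polar form of a quadratic form. -/
theorem LinearMap.BilinForm.exists_polar_eq_of_self_eq_zero {k V : Type*} [Field k] [CharP k 2]
    [AddCommGroup V] [Module k V] [FiniteDimensional k V]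
    (β : V →ₗ[k] V →ₗ[k] k) (halt : ∀ v : V, β v v = 0) :
    ∃ q : QuadraticForm k V, ∀ v w : V, QuadraticMap.polar q v w = β v w := by
  let b := Module.finBasis k V
  let B : V →ₗ[k] V →ₗ[k] k :=
    b.constr k fun i => b.constr k fun j => if i < j then β (b i) (b j) else 0
  have hBb (i j) : B (b i) (b j) = if i < j then β (b i) (b j) else 0 := by
    simp only [B, Module.Basis.constr_basis]
  have hB : B + B.flip = β := by
    refine b.ext fun i => b.ext fun j => ?_
    have hsymm : β (b j) (b i) = β (b i) (b j) := by
      rw [← LinearMap.IsAlt.neg (B := β) halt, CharTwo.neg_eq]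
    rw [LinearMap.add_apply, LinearMap.add_apply, LinearMap.flip_apply, hBb, hBb]
    rcases lt_trichotomy i j with h | rfl | h
    · simp [h, h.not_gt]
    · simp [halt]
    · simp [h, h.not_gt, hsymm]
  refine ⟨LinearMap.BilinMap.toQuadraticMap B, fun v w => ?_⟩
  rw [LinearMap.BilinMap.polar_toQuadraticMap, ← hB]
  rfl

theorem stmt5 (k : Type*) [Field k] [CharP k 2] (G : Type*) [Group G]
    (V : Type*) [AddCommGroup V] [Module k V] [FiniteDimensional k V]
    (ρ : Representation k G V)
    -- H¹(G, T) = 0, where T is the space of totally singular quadratic forms on V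
    -- with the action g • q = q ∘ ρ(g⁻¹): every 1-cocycle is a coboundary.
    (hH1 : ∀ c : G → QuadraticForm k V,
      (∀ g : G, ∀ v w : V, QuadraticMap.polar (⇑(c g)) v w = 0) →
      (∀ g h : G, c (g * h) = c g + (c h).comp (ρ g⁻¹)) →
      ∃ t : QuadraticForm k V, (∀ v w : V, QuadraticMap.polar (⇑t) v w = 0) ∧
        ∀ g : G, c g = t.comp (ρ g⁻¹) - t)
    -- β is a G-invariant alternating bilinear form on V:
    (β : V →ₗ[k] V →ₗ[k] k)
    (halt : ∀ v : V, β v v = 0)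
    (hinv : ∀ (g : G) (v w : V), β (ρ g v) (ρ g w) = β v w) :
    -- then β is the polar form of a G-invariant quadratic form:
    ∃ q : QuadraticForm k V, (∀ (g : G) (v : V), q (ρ g v) = q v) ∧
      ∀ v w : V, QuadraticMap.polar (⇑q) v w = β v w := by
  obtain ⟨q, hq⟩ := LinearMap.BilinForm.exists_polar_eq_of_self_eq_zero β halt
  obtain ⟨t, ht, hqt⟩ := hH1 (fun g => q.comp (ρ g⁻¹) - q)
    (fun g v w => by
      have h : QuadraticMap.polar q (ρ g⁻¹ v) (ρ g⁻¹ w) = QuadraticMap.polar q v w := by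
        rw [hq, hq, hinv]
      simp only [QuadraticMap.polar, sub_apply, QuadraticMap.comp_apply,
        map_add] at h ⊢
      linear_combination h)
    (fun g h => by
      ext v
      simp [mul_inv_rev])
  refine ⟨q - t, fun g v => ?_, fun v w => ?_⟩
  · have h := DFunLike.congr_fun (hqt g⁻¹) v
    simp only [sub_apply, QuadraticMap.comp_apply, inv_inv] at h ⊢
    linear_combination h
  · have h₁ := hq v w
    have h₂ := ht v w
    simp only [QuadraticMap.polar, sub_apply] at h₁ h₂ ⊢
    linear_combination h₁ - h₂
end

section
/- Let k be a field, G a group, and V a finite-dimensional (hence finite-length) linear representation of G over k. Let rad V denote the intersection of all maximal subrepresentations of V and head V := V/rad V. Let U ⊆ rad V be a subrepresentation such that no simple G-representation occurs both as a composition factor of U and as a composition factor of (head V)^* (the dual representation of the head). Then the pullback map (Bil(V/U))^G → (Bil V)^G, β ↦ ((v,w) ↦ β(v+U, w+U)), is an isomorphism of k-vector spaces. -/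
/-!
STATEMENT 7: Let k be a field, G a group, V a finite-dimensional representation of
G over k, rad V the intersection of all maximal subrepresentations, and
U ⊆ rad V a subrepresentation such that no simple G-representation occurs both as
a composition factor of U and as a composition factor of (head V)^* (the dual of
V/rad V, realized as the annihilator of rad V in V^* with the contragredient
action).  Then the pullback map (Bil(V/U))^G → (Bil V)^G is an isomorphism.
-/

universe u v

variable (k : Type u) [Field k] (G : Type*) [Group G]
  (V : Type v) [AddCommGroup V] [Module k V]

/-- A submodule is `G`-stable for the representation `ρ`. -/
def IsSubrep (ρ : Representation k G V) (W : Submodule k V) : Prop :=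
  ∀ g : G, ∀ v ∈ W, ρ g v ∈ W

/-- The radical of the representation `(V, ρ)`: the intersection of all maximal
(proper) subrepresentations. -/
def repRadical (ρ : Representation k G V) : Submodule k V :=
  sInf {W : Submodule k V | IsSubrep k G V ρ W ∧ W ≠ ⊤ ∧
    ∀ W' : Submodule k V, IsSubrep k G V ρ W' → W < W' → W' = ⊤}

/-- A representation `(L, σ)` is simple: nonzero, with no nontrivial proper
stable submodule. -/
def IsSimpleRep (L : Type*) [AddCommGroup L] [Module k L]
    (σ : Representation k G L) : Prop :=
  Nontrivial L ∧ ∀ X : Submodule k L, IsSubrep k G L σ X → X = ⊥ ∨ X = ⊤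

/-- The simple representation `(L, σ)` is a composition factor of the stable
submodule `M` of `(V, ρ)`: there are a stable submodule `B ≤ M` and an
equivariant linear surjection `B ↠ L`. -/
def IsCompFactorOf (ρ : Representation k G V)
    (L : Type*) [AddCommGroup L] [Module k L] (σ : Representation k G L)
    (M : Submodule k V) : Prop :=
  ∃ (B : Submodule k V) (hB : IsSubrep k G V ρ B), B ≤ M ∧
    ∃ π : B →ₗ[k] L, Function.Surjective π ∧
      ∀ (g : G) (x : B), π ⟨ρ g ↑x, hB g ↑x x.2⟩ = σ g (π x)

/-- The contragredient representation on `V^* = Dual k V`: `(g · f)(v) = f(g⁻¹ v)`. -/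
noncomputable def dualRep (ρ : Representation k G V) : Representation k G (Module.Dual k V) where
  toFun g := (ρ g⁻¹).dualMap
  map_one' := by ext f v; simp
  map_mul' g h := by ext f v; simp [mul_comm]

section InvariantForms

variable {k : Type u} [Field k] {G : Type*} [Group G] {V : Type v} [AddCommGroup V] [Module k V]

lemma dualRep_apply_apply (ρ : Representation k G V) (g : G) (f : Module.Dual k V) (v : V) :
    dualRep k G V ρ g f v = f (ρ g⁻¹ v) := rfl

lemma IsSubrep.map {W : Type*} [AddCommGroup W] [Module k W] {ρ : Representation k G V}
    {τ : Representation k G W} {φ : V →ₗ[k] W} (hφ : ∀ g v, φ (ρ g v) = τ g (φ v))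
    {U : Submodule k V} (hU : IsSubrep k G V ρ U) : IsSubrep k G W τ (U.map φ) := by
  rintro g _ ⟨u, hu, rfl⟩
  exact ⟨ρ g u, hU g u hu, hφ g u⟩

lemma IsSubrep.dualAnnihilator {ρ : Representation k G V} {W : Submodule k V}
    (hW : IsSubrep k G V ρ W) :
    IsSubrep k G (Module.Dual k V) (dualRep k G V ρ) W.dualAnnihilator := by
  intro g f hf
  rw [Submodule.mem_dualAnnihilator] at hf ⊢
  exact fun w hw => hf _ (hW g⁻¹ w hw)

lemma IsSubrep.dualCoannihilator {ρ : Representation k G V} {S : Submodule k (Module.Dual k V)}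
    (hS : IsSubrep k G (Module.Dual k V) (dualRep k G V ρ) S) :
    IsSubrep k G V ρ S.dualCoannihilator := by
  intro g v hv
  rw [Submodule.mem_dualCoannihilator] at hv ⊢
  intro f hf
  simpa [dualRep_apply_apply] using hv _ (hS g⁻¹ f hf)

/-- A nonzero stable submodule of a finite-dimensional representation contains a minimal one. -/
lemma IsSubrep.exists_minimal_le [FiniteDimensional k V] {ρ : Representation k G V}
    {T : Submodule k V} (hT : IsSubrep k G V ρ T) (hT0 : T ≠ ⊥) :
    ∃ S ≤ T, Minimal (fun S => IsSubrep k G V ρ S ∧ S ≠ ⊥) S :=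
  exists_minimal_le_of_wellFoundedLT _ T ⟨hT, hT0⟩

/-- Minimal stable submodules of the dual annihilate the radical. -/
lemma le_dualAnnihilator_repRadical [FiniteDimensional k V] {ρ : Representation k G V}
    {S : Submodule k (Module.Dual k V)}
    (hS : Minimal (fun S => IsSubrep k G (Module.Dual k V) (dualRep k G V ρ) S ∧ S ≠ ⊥) S) :
    S ≤ (repRadical k G V ρ).dualAnnihilator := by
  rw [Submodule.le_dualAnnihilator_iff_le_dualCoannihilator]
  refine sInf_le ⟨hS.prop.1.dualCoannihilator, fun h => hS.prop.2 ?_, fun W' hW' hlt => ?_⟩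
  · rw [← Subspace.dualCoannihilator_dualAnnihilator_eq (W := S), h,
      Submodule.dualAnnihilator_top]
  · by_contra hne
    have hle : W'.dualAnnihilator ≤ S := by
      rw [← Subspace.dualCoannihilator_dualAnnihilator_eq (W := S)]
      exact Submodule.dualAnnihilator_anti hlt.le
    have h := hS.le_of_le ⟨hW'.dualAnnihilator, fun h => hne ?_⟩ hle
    · rw [Submodule.le_dualAnnihilator_iff_le_dualCoannihilator] at h
      exact hlt.not_ge h
    · rw [← Subspace.dualAnnihilator_dualCoannihilator_eq (W := W'), h,
        Submodule.dualCoannihilator_bot]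

/-- Transport of a minimal stable submodule along a linear equivalence gives a simple
representation. -/
lemma exists_isSimpleRep_of_linearEquiv {τ : Representation k G V} {S : Submodule k V}
    (hS : Minimal (fun S => IsSubrep k G V τ S ∧ S ≠ ⊥) S)
    {L : Type*} [AddCommGroup L] [Module k L] (e : L ≃ₗ[k] S) :
    ∃ σ : Representation k G L, (∀ g x, (e (σ g x) : V) = τ g (e x)) ∧
      IsSimpleRep k G L σ := by
  let σ : Representation k G L :=
    { toFun g := e.symm.toLinearMap ∘ₗ
        (τ g).restrict (fun s hs => hS.prop.1 g s hs) ∘ₗ e.toLinearMap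
      map_one' := by
        ext x
        simp [LinearMap.restrict_apply]
      map_mul' g h := by
        ext x
        simp [LinearMap.restrict_apply] }
  have hσ (g : G) (x : L) : (e (σ g x) : V) = τ g (e x) := by
    simp [σ]
  have := Submodule.nontrivial_iff_ne_bot.2 hS.prop.2
  refine ⟨σ, hσ, e.toEquiv.nontrivial, fun X hX => or_iff_not_imp_left.2 fun hX0 => ?_⟩
  let j : L →ₗ[k] V := S.subtype ∘ₗ e.toLinearMap
  have hj : Function.Injective j := S.injective_subtype.comp e.injective
  have hle : X.map j ≤ S := by
    rintro _ ⟨x, -, rfl⟩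
    exact (e x).2
  have hSX := hS.le_of_le ⟨hX.map (φ := j) hσ, fun h => hX0 ?_⟩ hle
  · refine eq_top_iff.2 fun x _ => ?_
    obtain ⟨y, hy, hyx⟩ := hSX (e x).2
    exact hj hyx ▸ hy
  · exact Submodule.map_injective_of_injective hj (h.trans (Submodule.map_bot j).symm)

/-- A quotient of `V` has a model in the universe of `V`. -/
lemma exists_linearEquiv_of_surjective {M : Type*} [AddCommGroup M] [Module k M]
    (f : V →ₗ[k] M) (hf : Function.Surjective f) :
    ∃ (L : Type v) (_ : AddCommGroup L) (_ : Module k L), Nonempty (L ≃ₗ[k] M) :=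
  ⟨V ⧸ LinearMap.ker f, inferInstance, inferInstance, ⟨f.quotKerEquivOfSurjective hf⟩⟩

/-- An equivariant map to the dual kills `U` if `U` and the dual of the head have no common
composition factor. -/
lemma map_dual_eq_zero_of_disjoint_compFactors [FiniteDimensional k V]
    (ρ : Representation k G V) {U : Submodule k V} (hU : IsSubrep k G V ρ U)
    (hdisj : ∀ (L : Type v) [AddCommGroup L] [Module k L]
      (σ : Representation k G L), IsSimpleRep k G L σ →
        ¬(IsCompFactorOf k G V ρ L σ U ∧
          IsCompFactorOf k G (Module.Dual k V) (dualRep k G V ρ) L σ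
            (Submodule.dualAnnihilator (repRadical k G V ρ))))
    (φ : V →ₗ[k] Module.Dual k V) (hφ : ∀ g v, φ (ρ g v) = dualRep k G V ρ g (φ v))
    {u : V} (hu : u ∈ U) : φ u = 0 := by
  by_contra hne
  obtain ⟨S, hST, hS⟩ := (hU.map hφ).exists_minimal_le
    (fun h => hne ((Submodule.mem_bot k).1 (h ▸ Submodule.mem_map_of_mem hu)))
  have hB : IsSubrep k G V ρ (U ⊓ S.comap φ) := fun g v hv =>
    ⟨hU g v hv.1, by simpa [hφ] using hS.prop.1 g _ hv.2⟩
  obtain ⟨f, hf, hfφ⟩ : ∃ f : ↥(U ⊓ S.comap φ) →ₗ[k] S,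
      Function.Surjective f ∧ ∀ x, (f x : Module.Dual k V) = φ x := by
    refine ⟨φ.restrict fun v hv => hv.2, ?_, fun x => rfl⟩
    rintro ⟨s, hs⟩
    obtain ⟨v, hv, rfl⟩ := hST hs
    exact ⟨⟨v, hv, hs⟩, rfl⟩
  obtain ⟨L, _, _, ⟨e⟩⟩ := exists_linearEquiv_of_surjective (k := k) (V := ↥(U ⊓ S.comap φ)) (M := S) f hf
  obtain ⟨σ, hσ, hsimple⟩ := exists_isSimpleRep_of_linearEquiv hS e
  refine hdisj _ σ hsimple ⟨?_, ?_⟩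
  · refine ⟨_, hB, inf_le_left, e.symm.toLinearMap ∘ₗ f, e.symm.surjective.comp hf, fun g x => ?_⟩
    refine e.injective (Subtype.ext ?_)
    rw [hσ]
    simpa [hfφ] using hφ g x
  · refine ⟨S, hS.prop.1, le_dualAnnihilator_repRadical hS, e.symm.toLinearMap,
      e.symm.surjective, fun g x => ?_⟩
    refine e.injective (Subtype.ext ?_)
    rw [hσ]
    simp

end InvariantForms

theorem stmt7 [FiniteDimensional k V] (ρ : Representation k G V)
    (U : Submodule k V) (hUsub : IsSubrep k G V ρ U)
    (hUrad : U ≤ repRadical k G V ρ)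
    -- no simple representation is a composition factor of both U and
    -- (head V)^* = (rad V)^⊥ ⊆ V^* :
    (hdisj : ∀ (L : Type v) [AddCommGroup L] [Module k L]
      (σ : Representation k G L), IsSimpleRep k G L σ →
        ¬(IsCompFactorOf k G V ρ L σ U ∧
          IsCompFactorOf k G (Module.Dual k V) (dualRep k G V ρ) L σ
            (Submodule.dualAnnihilator (repRadical k G V ρ)))) :
    -- then pulling back along V → V/U is a bijection between the G-invariant
    -- bilinear forms on V/U and those on V:
    Function.Bijective
      (fun β : {β : (V ⧸ U) →ₗ[k] (V ⧸ U) →ₗ[k] k //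
          ∀ (g : G) (v w : V),
            β (Submodule.Quotient.mk (ρ g v)) (Submodule.Quotient.mk (ρ g w)) =
              β (Submodule.Quotient.mk v) (Submodule.Quotient.mk w)} =>
        (⟨((β : (V ⧸ U) →ₗ[k] (V ⧸ U) →ₗ[k] k) ∘ₗ U.mkQ).compl₂ U.mkQ,
          fun g v w => by simpa using β.2 g v w⟩ :
          {b : V →ₗ[k] V →ₗ[k] k //
            ∀ (g : G) (v w : V), b (ρ g v) (ρ g w) = b v w})) := by
  have key (b : V →ₗ[k] V →ₗ[k] k) (hb : ∀ (g : G) (v w : V), b (ρ g v) (ρ g w) = b v w) :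
      ∀ u ∈ U, b u = 0 := fun u hu =>
    map_dual_eq_zero_of_disjoint_compFactors ρ hUsub hdisj b (fun g v => by
      ext w
      rw [dualRep_apply_apply, ← hb g v]
      simp) hu
  constructor
  · rintro ⟨β, _⟩ ⟨γ, _⟩ h
    have h' := congrArg Subtype.val h
    refine Subtype.ext ?_
    ext v w
    exact LinearMap.congr_fun₂ h' v w
  · rintro ⟨b, hb⟩
    refine ⟨⟨(U.liftQ (U.liftQ b (key b hb)).flip fun u hu => ?_).flip, hb⟩, rfl⟩
    ext v
    exact LinearMap.congr_fun (key b.flip (fun g v w => hb g w v) u hu) v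
end

section
/- Let k be a field and let V₁, V₂ be finite-dimensional k-vector spaces equipped with alternating bilinear forms b₁, b₂ (so bᵢ(v,v) = 0 for all v). Then there is a unique quadratic form q on V₁ ⊗ V₂ such that q(Σᵢ v_{1i} ⊗ v_{2i}) = Σ_{i<j} b₁(v_{1i}, v_{1j}) · b₂(v_{2i}, v_{2j}) for every finite family of vectors v_{ℓi} ∈ V_ℓ. The polar bilinear form of q satisfies b_q(u₁ ⊗ u₂, w₁ ⊗ w₂) = b₁(u₁,w₁) · b₂(u₂,w₂) on pure tensors. If b₁ and b₂ are nondegenerate, then q is nondegenerate (its radical {v ∈ V₁⊗V₂ : b_q(v,·) = 0 and q(v) = 0} is zero). If bᵢ is invariant under a group Gᵢ acting linearly on Vᵢ (i = 1,2), then q is invariant under the natural action of G₁ × G₂ on V₁ ⊗ V₂. -/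
/-!
STATEMENT 9: Let k be a field and V₁, V₂ finite-dimensional k-vector spaces with
alternating bilinear forms b₁, b₂.  There is a unique quadratic form q on V₁ ⊗ V₂
with q(Σᵢ v_{1i} ⊗ v_{2i}) = Σ_{i<j} b₁(v_{1i},v_{1j})·b₂(v_{2i},v_{2j}); its
polar form is b₁ ⊗ b₂ on pure tensors; q is nondegenerate when b₁, b₂ are; and q
is invariant under G₁ × G₂ whenever bᵢ is Gᵢ-invariant.
-/

open scoped TensorProduct

/-- A symmetric bilinear form vanishing on the diagonal of a basis is the polar form of
a quadratic form vanishing on that basis. -/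
lemma exists_quadraticForm_polarBilin_eq {R M ι : Type*} [CommRing R] [AddCommGroup M] [Module R M]
    (e : Module.Basis ι R M) (T : LinearMap.BilinForm R M) (hT : ∀ x y, T x y = T y x)
    (hdiag : ∀ i, T (e i) (e i) = 0) :
    ∃ Q : QuadraticForm R M, Q.polarBilin = T ∧ ∀ i, Q (e i) = 0 := by
  classical
  obtain ⟨_, -⟩ := exists_wellFoundedLT ι
  let B : LinearMap.BilinForm R M :=
    e.constr R fun i => e.constr R fun j => if i < j then T (e i) (e j) else 0
  have hB (i j : ι) : B (e i) (e j) = if i < j then T (e i) (e j) else 0 := by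
    simp [B, Module.Basis.constr_basis]
  refine ⟨LinearMap.BilinMap.toQuadraticMap B, ?_, fun i => ?_⟩
  · rw [LinearMap.BilinMap.polarBilin_toQuadraticMap]
    refine e.ext fun i => e.ext fun j => ?_
    rw [LinearMap.add_apply, LinearMap.add_apply, LinearMap.flip_apply, hB, hB]
    rcases lt_trichotomy i j with h | rfl | h
    · simp [h, h.not_gt]
    · simp [hdiag]
    · simp [h, h.not_gt, hT]
  · simp [LinearMap.BilinMap.toQuadraticMap_apply, hB]

/-- A quadratic map with zero polar form that vanishes on a basis is zero. -/
lemma QuadraticMap.apply_eq_zero_of_polar_eq_zero {R M N ι : Type*} [CommRing R] [AddCommGroup M]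
    [Module R M] [AddCommGroup N] [Module R N] (e : Module.Basis ι R M) (Q : QuadraticMap R M N)
    (hp : ∀ x y, QuadraticMap.polar Q x y = 0) (he : ∀ i, Q (e i) = 0) (x : M) : Q x = 0 := by
  have hx : x ∈ Submodule.span R (Set.range e) := e.mem_span x
  induction hx using Submodule.span_induction with
  | zero => exact Q.map_zero
  | add x y _ _ hx hy => rw [QuadraticMap.map_add (Q : M → N), hx, hy, hp, add_zero, add_zero]
  | smul c x _ hx => rw [QuadraticMap.map_smul, hx, smul_zero]
  | mem x hx => obtain ⟨i, rfl⟩ := hx; exact he i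

/-- The value of a quadratic map on a finite sum, in terms of ordered pairs of indices. -/
lemma QuadraticMap.map_sum_fin {R M N : Type*} [CommRing R] [AddCommGroup M] [Module R M]
    [AddCommGroup N] [Module R N] (Q : QuadraticMap R M N) :
    ∀ (m : ℕ) (x : Fin m → M), Q (∑ i, x i) = ∑ i, Q (x i) +
      ∑ i, ∑ j, if i < j then QuadraticMap.polar Q (x i) (x j) else 0
  | 0, x => by simp
  | m + 1, x => by
    have hs : QuadraticMap.polar Q (x 0) (∑ i : Fin m, x i.succ) =
        ∑ i : Fin m, QuadraticMap.polar Q (x 0) (x i.succ) :=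
      map_sum (Q.polarBilin (x 0)) _ _
    simp only [Fin.sum_univ_succ, Fin.succ_lt_succ_iff, Fin.succ_pos, Fin.not_lt_zero, if_true,
      if_false, zero_add]
    rw [QuadraticMap.map_add (Q : M → N), Q.map_sum_fin m, hs]
    abel

/-- The tensor product of two alternating bilinear forms is the polar form of a quadratic form
vanishing on pure tensors. -/
lemma exists_quadraticForm_tensor {R V₁ V₂ : Type*} [CommRing R] [AddCommGroup V₁] [Module R V₁]
    [AddCommGroup V₂] [Module R V₂] [Module.Free R V₁] [Module.Free R V₂]
    (b₁ : LinearMap.BilinForm R V₁) (b₂ : LinearMap.BilinForm R V₂)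
    (h₁ : b₁.IsAlt) (h₂ : b₂.IsAlt) :
    ∃ Q : QuadraticForm R (V₁ ⊗[R] V₂), (∀ v w, Q (v ⊗ₜ w) = 0) ∧
      ∀ u₁ w₁ u₂ w₂, QuadraticMap.polar Q (u₁ ⊗ₜ[R] u₂) (w₁ ⊗ₜ[R] w₂) = b₁ u₁ w₁ * b₂ u₂ w₂ := by
  let T : LinearMap.BilinForm R (V₁ ⊗[R] V₂) :=
    TensorProduct.dualDistrib R V₁ V₂ ∘ₗ TensorProduct.map b₁ b₂
  have hT (u₁ w₁ u₂ w₂) : T (u₁ ⊗ₜ u₂) (w₁ ⊗ₜ w₂) = b₁ u₁ w₁ * b₂ u₂ w₂ := rfl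
  have hsymm : T = T.flip := by
    ext u₁ u₂ w₁ w₂
    change b₁ u₁ w₁ * b₂ u₂ w₂ = b₁ w₁ u₁ * b₂ w₂ u₂
    rw [← LinearMap.IsAlt.neg h₁, ← LinearMap.IsAlt.neg h₂, neg_mul_neg]
  let e := Module.Free.chooseBasis R V₁
  let f := Module.Free.chooseBasis R V₂
  obtain ⟨Q, hQ, hQ0⟩ := exists_quadraticForm_polarBilin_eq (e.tensorProduct f) T
    (fun x y => LinearMap.congr_fun₂ hsymm x y) fun i => by
      rw [Module.Basis.tensorProduct_apply', hT, h₁, zero_mul]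
  have hpolar (u₁ w₁ u₂ w₂) :
      QuadraticMap.polar Q (u₁ ⊗ₜ[R] u₂) (w₁ ⊗ₜ[R] w₂) = b₁ u₁ w₁ * b₂ u₂ w₂ := by
    rw [← QuadraticMap.polarBilin_apply_apply, hQ, hT]
  refine ⟨Q, fun v w => ?_, hpolar⟩
  refine (Q.comp ((TensorProduct.mk R V₁ V₂).flip w)).apply_eq_zero_of_polar_eq_zero e
    (fun x y => ?_) (fun i => ?_) v
  · simp only [QuadraticMap.polar, QuadraticMap.comp_apply, map_add]
    exact (hpolar x y w w).trans (by rw [h₂, mul_zero])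
  refine (Q.comp (TensorProduct.mk R V₁ V₂ (e i))).apply_eq_zero_of_polar_eq_zero f
    (fun x y => ?_) (fun j => ?_) w
  · simp only [QuadraticMap.polar, QuadraticMap.comp_apply, map_add]
    exact (hpolar (e i) (e i) x y).trans (by rw [h₁, zero_mul])
  · simpa using hQ0 (i, j)

theorem stmt9 (k : Type*) [Field k]
    (V₁ V₂ : Type*) [AddCommGroup V₁] [Module k V₁] [AddCommGroup V₂] [Module k V₂]
    [FiniteDimensional k V₁] [FiniteDimensional k V₂]
    (b₁ : V₁ →ₗ[k] V₁ →ₗ[k] k) (b₂ : V₂ →ₗ[k] V₂ →ₗ[k] k)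
    (halt₁ : ∀ v : V₁, b₁ v v = 0) (halt₂ : ∀ v : V₂, b₂ v v = 0)
    (G₁ G₂ : Type*) [Group G₁] [Group G₂]
    (ρ₁ : Representation k G₁ V₁) (ρ₂ : Representation k G₂ V₂) :
    -- there is a unique quadratic form q with the stated values on sums of
    -- pure tensors ...
    (∃! q : QuadraticForm k (V₁ ⊗[k] V₂),
      ∀ (m : ℕ) (v : Fin m → V₁) (w : Fin m → V₂),
        q (∑ i : Fin m, v i ⊗ₜ[k] w i) =
          ∑ i : Fin m, ∑ j : Fin m,
            if i < j then b₁ (v i) (v j) * b₂ (w i) (w j) else 0) ∧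
    -- ... and any such q has the following properties:
    ∀ q : QuadraticForm k (V₁ ⊗[k] V₂),
      (∀ (m : ℕ) (v : Fin m → V₁) (w : Fin m → V₂),
        q (∑ i : Fin m, v i ⊗ₜ[k] w i) =
          ∑ i : Fin m, ∑ j : Fin m,
            if i < j then b₁ (v i) (v j) * b₂ (w i) (w j) else 0) →
      -- its polar bilinear form is b₁ ⊗ b₂ on pure tensors:
      ((∀ (u₁ w₁ : V₁) (u₂ w₂ : V₂),
          QuadraticMap.polar (⇑q) (u₁ ⊗ₜ[k] u₂) (w₁ ⊗ₜ[k] w₂) = b₁ u₁ w₁ * b₂ u₂ w₂) ∧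
      -- if b₁ and b₂ are nondegenerate then q is nondegenerate (has zero radical):
      ((∀ v : V₁, (∀ w, b₁ v w = 0) → v = 0) → (∀ v : V₂, (∀ w, b₂ v w = 0) → v = 0) →
        ∀ x : V₁ ⊗[k] V₂, (∀ y, QuadraticMap.polar (⇑q) x y = 0) → q x = 0 → x = 0) ∧
      -- if b₁, b₂ are invariant under G₁, G₂ then q is invariant under G₁ × G₂:
      ((∀ (g : G₁) (v w : V₁), b₁ (ρ₁ g v) (ρ₁ g w) = b₁ v w) →
        (∀ (g : G₂) (v w : V₂), b₂ (ρ₂ g v) (ρ₂ g w) = b₂ v w) →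
        ∀ (g₁ : G₁) (g₂ : G₂) (x : V₁ ⊗[k] V₂),
          q (TensorProduct.map (ρ₁ g₁) (ρ₂ g₂) x) = q x)) := by
  refine ⟨existsUnique_of_exists_of_unique ?_ ?_, fun q hq => ?_⟩
  · obtain ⟨Q, hQ0, hQ⟩ := exists_quadraticForm_tensor b₁ b₂ halt₁ halt₂
    exact ⟨Q, fun m v w => by simp [Q.map_sum_fin, hQ0, hQ]⟩
  · intro q q' hq hq'
    ext x
    obtain ⟨m, v, w, rfl⟩ := TensorProduct.exists_sum_tmul_eq x
    rw [hq, hq']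
  have hpure (v : V₁) (w : V₂) : q (v ⊗ₜ w) = 0 := by
    simpa using hq 1 (fun _ => v) fun _ => w
  have hpolar (u₁ w₁ : V₁) (u₂ w₂ : V₂) :
      QuadraticMap.polar q (u₁ ⊗ₜ[k] u₂) (w₁ ⊗ₜ[k] w₂) = b₁ u₁ w₁ * b₂ u₂ w₂ := by
    have h := hq 2 ![u₁, w₁] ![u₂, w₂]
    simp only [Fin.sum_univ_two] at h
    simpa [QuadraticMap.polar, hpure] using h
  refine ⟨hpolar, fun hb₁ hb₂ x hx _ => ?_, fun hg₁ hg₂ g₁ g₂ x => ?_⟩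
  · have hT : q.polarBilin = TensorProduct.dualDistrib k V₁ V₂ ∘ₗ TensorProduct.map b₁ b₂ := by
      ext u₁ u₂ w₁ w₂
      exact hpolar u₁ w₁ u₂ w₂
    have hi₁ : Function.Injective b₁ := (injective_iff_map_eq_zero b₁).2 fun v hv =>
      hb₁ v fun w => by rw [hv, LinearMap.zero_apply]
    have hi₂ : Function.Injective b₂ := (injective_iff_map_eq_zero b₂).2 fun v hv =>
      hb₂ v fun w => by rw [hv, LinearMap.zero_apply]
    have hinj : Function.Injective q.polarBilin := by
      rw [hT]
      exact (TensorProduct.dualDistribEquiv k V₁ V₂).injective.comp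
        (TensorProduct.map_injective_of_flat_flat b₁ b₂ hi₁ hi₂)
    exact hinj ((LinearMap.ext hx).trans (map_zero _).symm)
  · obtain ⟨m, v, w, rfl⟩ := TensorProduct.exists_sum_tmul_eq x
    simp [hq, hg₁, hg₂]
end

section
/- Let k be an infinite field and b a nondegenerate alternating bilinear form on a nonzero finite-dimensional k-vector space V. Then every quadratic form q on V that is invariant under the symplectic group Sp(V,b) = {g ∈ GL(V) : b(gv,gw) = b(v,w) for all v,w ∈ V} (i.e., q(gv) = q(v) for all g ∈ Sp(V,b) and v ∈ V) is the zero form. -/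
/-- The symplectic transvection `x ↦ x + a * b u x • u` of an alternating form `b`. -/
def symplecticTransvection {k V : Type*} [Field k] [AddCommGroup V] [Module k V]
    (b : V →ₗ[k] V →ₗ[k] k) (halt : ∀ v : V, b v v = 0) (u : V) (a : k) : V ≃ₗ[k] V where
  toFun x := x + (a * b u x) • u
  map_add' x y := by
    simp only [map_add]
    module
  map_smul' c x := by
    simp only [map_smul, smul_eq_mul, RingHom.id_apply]
    module
  invFun x := x - (a * b u x) • u
  left_inv x := by simp [halt]
  right_inv x := by simp [halt]

theorem symplecticTransvection_apply {k V : Type*} [Field k] [AddCommGroup V] [Module k V]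
    (b : V →ₗ[k] V →ₗ[k] k) (halt : ∀ v : V, b v v = 0) (u : V) (a : k) (x : V) :
    symplecticTransvection b halt u a x = x + (a * b u x) • u := rfl

theorem symplecticTransvection_isometry {k V : Type*} [Field k] [AddCommGroup V] [Module k V]
    (b : V →ₗ[k] V →ₗ[k] k) (halt : ∀ v : V, b v v = 0) (u : V) (a : k) (v w : V) :
    b (symplecticTransvection b halt u a v) (symplecticTransvection b halt u a w) = b v w := by
  have hneg : b v u = -b u v := (LinearMap.IsAlt.neg (B := b) halt u v).symm
  simp only [symplecticTransvection_apply, map_add, map_smul, LinearMap.add_apply,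
    LinearMap.smul_apply, smul_eq_mul, halt, hneg]
  ring

/-!
STATEMENT 15: Let k be an infinite field and b a nondegenerate alternating
bilinear form on a nonzero finite-dimensional k-vector space V.  Then every
quadratic form on V invariant under the symplectic group Sp(V,b) is zero.
-/

theorem stmt15 (k : Type*) [Field k] [Infinite k]
    (V : Type*) [AddCommGroup V] [Module k V] [FiniteDimensional k V] [Nontrivial V]
    (b : V →ₗ[k] V →ₗ[k] k)
    (halt : ∀ v : V, b v v = 0)
    (hnd : ∀ v : V, (∀ w : V, b v w = 0) → v = 0)
    (q : QuadraticForm k V)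
    (hq : ∀ g : V ≃ₗ[k] V, (∀ v w : V, b (g v) (g w) = b v w) →
      ∀ v : V, q (g v) = q v) :
    q = 0 := by
  ext u
  by_cases hu : u = 0
  · simp [hu]
  obtain ⟨x, hx⟩ : ∃ x, b u x ≠ 0 := by
    by_contra! h
    exact hu (hnd u h)
  have key (c : k) : c * QuadraticMap.polar q x u + c * c * q u = 0 := by
    have h := hq (symplecticTransvection b halt u (c / b u x))
      (symplecticTransvection_isometry b halt u _) x
    rw [symplecticTransvection_apply, div_mul_cancel₀ c hx, QuadraticMap.map_add q,
      QuadraticMap.map_smul, QuadraticMap.polar_smul_right, smul_eq_mul, smul_eq_mul] at h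
    linear_combination h
  classical
  obtain ⟨t, ht⟩ := Infinite.exists_notMem_finset ({0, 1} : Finset k)
  simp only [Finset.mem_insert, Finset.mem_singleton, not_or] at ht
  have h : t * (t - 1) * q u = 0 := by linear_combination key t - t * key 1
  simpa [ht.1, sub_eq_zero, ht.2] using h
end

section
/- Let k be a field, V a finite-dimensional k-vector space, q a quadratic form on V, and U ⊆ V a subspace such that q(u + v) = q(v) for all u ∈ U and v ∈ V, so that q induces a quadratic form q̄ on V̄ := V/U. Let O(q,U) := {g ∈ GL(V) : q∘g = q and g(U) = U} and O(q̄) := {h ∈ GL(V̄) : q̄∘h = q̄}. Then the natural homomorphism O(q,U) → O(q̄) × GL(U), sending g to the pair consisting of the induced maps on V/U and on U, is surjective, and its kernel is isomorphic to the additive group Hom_k(V/U, U) via φ ↦ id_V + ι∘φ∘π (where π: V → V/U is the quotient map and ι: U → V the inclusion). That is, there is a short exact sequence of groups 1 → Hom_k(V/U, U) → O(q,U) → O(q̄) × GL(U) → 1. -/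
/-!
STATEMENT 16: Let q be a quadratic form on a finite-dimensional k-vector space V
and U ⊆ V a subspace with q(u + v) = q(v) for u ∈ U, v ∈ V, so q induces q̄ on
V/U.  Then there is a short exact sequence of groups
1 → Hom(V/U, U) → O(q,U) → O(q̄) × GL(U) → 1,
where Hom(V/U,U) embeds via φ ↦ id + ι∘φ∘π.
-/

open Submodule

/-- A linear endomorphism of `V` which induces automorphisms of `V ⧸ U` and of `U` is an automorphism
of `V` that stabilizes `U`. -/
theorem exists_linearEquiv_of_induced {k V : Type*} [Field k] [AddCommGroup V] [Module k V]
    [FiniteDimensional k V] (U : Submodule k V) (f : V →ₗ[k] V)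
    (h : (V ⧸ U) ≃ₗ[k] V ⧸ U) (e : U ≃ₗ[k] U)
    (hf : ∀ v : V, (Submodule.Quotient.mk (f v) : V ⧸ U) = h (Submodule.Quotient.mk v))
    (he : ∀ u : U, f u = (e u : V)) :
    ∃ g : V ≃ₗ[k] V, (∀ v, g v = f v) ∧ U.map (g : V →ₗ[k] V) = U := by
  have hinj : Function.Injective f := by
    rw [← LinearMap.ker_eq_bot, LinearMap.ker_eq_bot']
    intro v hv
    have hvU : v ∈ U := by
      rw [← Submodule.Quotient.mk_eq_zero U, ← h.map_eq_zero_iff, ← hf, hv,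
        Submodule.Quotient.mk_zero]
    have hev := he ⟨v, hvU⟩
    rw [hv] at hev
    have : e ⟨v, hvU⟩ = 0 := Subtype.ext hev.symm
    simpa using this
  refine ⟨LinearEquiv.ofInjectiveEndo f hinj, fun v => rfl, ?_⟩
  apply le_antisymm
  · rintro _ ⟨u, hu, rfl⟩
    exact (he ⟨u, hu⟩).symm ▸ (e ⟨u, hu⟩).2
  · intro y hy
    refine ⟨e.symm ⟨y, hy⟩, (e.symm ⟨y, hy⟩).2, ?_⟩
    exact (he _).trans (by simp)

theorem stmt16 (k : Type*) [Field k]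
    (V : Type*) [AddCommGroup V] [Module k V] [FiniteDimensional k V]
    (q : QuadraticForm k V) (U : Submodule k V)
    (hU : ∀ u ∈ U, ∀ v : V, q (u + v) = q v)
    -- q̄ is the quadratic form induced by q on V/U:
    (qbar : QuadraticForm k (V ⧸ U))
    (hqbar : ∀ v : V, qbar (Submodule.Quotient.mk v) = q v) :
    -- (a) the natural homomorphism O(q,U) → O(q̄) × GL(U) is well defined:
    -- every g ∈ O(q,U) induces an automorphism of V/U preserving q̄ and an
    -- automorphism of U ...
    (∀ g : V ≃ₗ[k] V, (∀ v, q (g v) = q v) → U.map (g : V →ₗ[k] V) = U →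
      (∃ h : (V ⧸ U) ≃ₗ[k] V ⧸ U,
          (∀ v : V, h (Submodule.Quotient.mk v) = Submodule.Quotient.mk (g v)) ∧
          ∀ x : V ⧸ U, qbar (h x) = qbar x) ∧
      (∃ e : U ≃ₗ[k] U, ∀ u : U, (e u : V) = g u)) ∧
    -- (b) ... it is surjective: every pair (h, e) ∈ O(q̄) × GL(U) lifts to
    -- some g ∈ O(q,U):
    (∀ h : (V ⧸ U) ≃ₗ[k] V ⧸ U, (∀ x : V ⧸ U, qbar (h x) = qbar x) →
      ∀ e : U ≃ₗ[k] U,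
        ∃ g : V ≃ₗ[k] V, (∀ v, q (g v) = q v) ∧ U.map (g : V →ₗ[k] V) = U ∧
          (∀ v : V, Submodule.Quotient.mk (g v) = h (Submodule.Quotient.mk v)) ∧
          (∀ u : U, g u = (e u : V))) ∧
    -- (c) ... its kernel consists exactly of the maps id + ι∘φ∘π for
    -- φ ∈ Hom(V/U, U):
    (∀ g : V ≃ₗ[k] V, (∀ v, q (g v) = q v) → U.map (g : V →ₗ[k] V) = U →
      (((∀ v : V, (Submodule.Quotient.mk (g v) : V ⧸ U) = Submodule.Quotient.mk v) ∧
          ∀ u : U, g u = (u : V)) ↔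
        ∃ φ : (V ⧸ U) →ₗ[k] U, ∀ v : V, g v = v + (φ (Submodule.Quotient.mk v) : V))) ∧
    -- (d) ... each φ ∈ Hom(V/U, U) indeed gives an element id + ι∘φ∘π of O(q,U):
    (∀ φ : (V ⧸ U) →ₗ[k] U,
      ∃ g : V ≃ₗ[k] V, (∀ v : V, g v = v + (φ (Submodule.Quotient.mk v) : V)) ∧
        (∀ v, q (g v) = q v) ∧ U.map (g : V →ₗ[k] V) = U) ∧
    -- (e) ... the embedding φ ↦ id + ι∘φ∘π is injective ...
    (∀ φ ψ : (V ⧸ U) →ₗ[k] U,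
      (∀ v : V, (φ (Submodule.Quotient.mk v) : V) = (ψ (Submodule.Quotient.mk v) : V)) →
      φ = ψ) ∧
    -- (f) ... and it is a group homomorphism from the additive group Hom(V/U, U):
    -- composition of automorphisms corresponds to addition of homomorphisms:
    (∀ (φ ψ : (V ⧸ U) →ₗ[k] U) (g₁ g₂ : V ≃ₗ[k] V),
      (∀ v : V, g₁ v = v + (φ (Submodule.Quotient.mk v) : V)) →
      (∀ v : V, g₂ v = v + (ψ (Submodule.Quotient.mk v) : V)) →
      ∀ v : V, g₁ (g₂ v) = v + ((φ + ψ) (Submodule.Quotient.mk v) : V)) := by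
  have hmkU (u : U) : (Submodule.Quotient.mk (u : V) : V ⧸ U) = 0 :=
    (Submodule.Quotient.mk_eq_zero U).2 u.2
  refine ⟨?_, ?_, ?_, ?_, ?_, ?_⟩
  · intro g hg hgU
    refine ⟨⟨Submodule.Quotient.equiv U U g hgU, fun v => rfl, fun x => ?_⟩,
      (g.submoduleMap U).trans (LinearEquiv.ofEq _ _ hgU), fun u => rfl⟩
    obtain ⟨v, rfl⟩ := Submodule.Quotient.mk_surjective U x
    exact (hqbar (g v)).trans ((hg v).trans (hqbar v).symm)
  · intro h hh e
    obtain ⟨s, hs⟩ := U.mkQ.exists_rightInverse_of_surjective U.range_mkQ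
    obtain ⟨r, hr⟩ := U.subtype.exists_leftInverse_of_injective U.ker_subtype
    have hs' (x : V ⧸ U) : (Submodule.Quotient.mk (s x) : V ⧸ U) = x := LinearMap.congr_fun hs x
    have hr' (u : U) : r u = u := LinearMap.congr_fun hr u
    let f : V →ₗ[k] V := s ∘ₗ h.toLinearMap ∘ₗ U.mkQ + U.subtype ∘ₗ e.toLinearMap ∘ₗ r
    have hf (v : V) : f v = s (h (Submodule.Quotient.mk v)) + (e (r v) : V) := rfl
    have hfh (v : V) :
        (Submodule.Quotient.mk (f v) : V ⧸ U) = h (Submodule.Quotient.mk v) := by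
      rw [hf, Submodule.Quotient.mk_add, hs', hmkU, add_zero]
    have hfe (u : U) : f u = (e u : V) := by
      rw [hf, hmkU, hr', map_zero, map_zero, zero_add]
    obtain ⟨g, hg, hgU⟩ := exists_linearEquiv_of_induced U f h e hfh hfe
    refine ⟨g, fun v => ?_, hgU, fun v => ?_, fun u => ?_⟩
    · rw [hg, ← hqbar, hfh, hh, hqbar]
    · rw [hg, hfh]
    · rw [hg, hfe]
  · intro g _ _
    constructor
    · rintro ⟨hgq, hgu⟩
      let d : V →ₗ[k] U := (g.toLinearMap - LinearMap.id).codRestrict U fun v =>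
        (Submodule.Quotient.eq U).1 (hgq v)
      have hd (v : V) : (d v : V) = g v - v := rfl
      refine ⟨U.liftQ d fun u hu => ?_, fun v => ?_⟩
      · apply Subtype.ext
        simpa [hd, sub_eq_zero] using hgu ⟨u, hu⟩
      · change g v = v + (d v : V)
        rw [hd, add_sub_cancel]
    · rintro ⟨φ, hφ⟩
      refine ⟨fun v => ?_, fun u => ?_⟩
      · rw [hφ, Submodule.Quotient.mk_add, hmkU, add_zero]
      · rw [hφ, hmkU, map_zero, Submodule.coe_zero, add_zero]
  · intro φ
    let f : V →ₗ[k] V := LinearMap.id + U.subtype ∘ₗ φ ∘ₗ U.mkQ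
    have hf (v : V) : f v = v + (φ (Submodule.Quotient.mk v) : V) := rfl
    obtain ⟨g, hg, hgU⟩ := exists_linearEquiv_of_induced U f (LinearEquiv.refl k _)
      (LinearEquiv.refl k _)
      (fun v => by rw [hf, Submodule.Quotient.mk_add, hmkU, add_zero, LinearEquiv.refl_apply])
      (fun u => by rw [hf, hmkU, map_zero, Submodule.coe_zero, add_zero, LinearEquiv.refl_apply])
    refine ⟨g, fun v => (hg v).trans (hf v), fun v => ?_, hgU⟩
    rw [hg, hf, add_comm, hU _ (φ _).2]
  · intro φ ψ hφψ
    ext v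
    exact hφψ v
  · intro φ ψ g₁ g₂ h₁ h₂ v
    rw [h₁, h₂, Submodule.Quotient.mk_add, hmkU, add_zero, LinearMap.add_apply,
      Submodule.coe_add]
    abel
end
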